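/- Full-meet multi-agent belief revision satisfies the generalized Subexpansion postulate: for every pointed Kripke model (M,s) with belief set K = K_{(M,s)}, every agent a ∈ A and all propositional formulas φ, ψ, if B_a ¬ψ ∉ K *_fm B_a φ, then (K *_fm B_a φ) + B_a ψ ⊆ K *_fm B_a(φ ∧ ψ), where ⊆ is the first-degree subset relation between belief sets and the expansion is performed on the pointed Kripke model representing K *_fm B_a φ. -/

import Mathlib

/-- Propositional formulas over a set of propositions `P` (no modalities). -/
inductive PForm (P : Type) : Type
  | atom : P → PForm P
  | neg : PForm P → PForm P
  | and : PForm P → PForm P → PForm P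
  | or : PForm P → PForm P → PForm P

/-- Classical satisfaction of a propositional formula by a truth assignment `v ⊆ P`. -/
def PForm.sat {P : Type} (v : Set P) : PForm P → Prop
  | PForm.atom p => p ∈ v
  | PForm.neg φ => ¬ PForm.sat v φ
  | PForm.and φ ψ => PForm.sat v φ ∧ PForm.sat v ψ
  | PForm.or φ ψ => PForm.sat v φ ∨ PForm.sat v ψ

/-- Belief formulas over agents `A` and propositions `P`. -/
inductive BForm (A P : Type) : Type
  | atom : P → BForm A P
  | neg : BForm A P → BForm A P
  | and : BForm A P → BForm A P → BForm A P
  | or : BForm A P → BForm A P → BForm A P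
  | bel : A → BForm A P → BForm A P

/-- Embedding of propositional formulas into belief formulas. -/
def PForm.toB {A P : Type} : PForm P → BForm A P
  | PForm.atom p => BForm.atom p
  | PForm.neg φ => BForm.neg (PForm.toB φ)
  | PForm.and φ ψ => BForm.and (PForm.toB φ) (PForm.toB ψ)
  | PForm.or φ ψ => BForm.or (PForm.toB φ) (PForm.toB ψ)

/-- A multi-agent Kripke model: worlds, accessibility relations, valuation. -/
structure Kripke (A P : Type) where
  W : Type
  R : A → W → W → Prop
  val : W → Set P

/-- Satisfaction of a belief formula at a world of a Kripke model. -/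
def Kripke.sat {A P : Type} (M : Kripke A P) : M.W → BForm A P → Prop
  | w, BForm.atom p => p ∈ M.val w
  | w, BForm.neg φ => ¬ M.sat w φ
  | w, BForm.and φ ψ => M.sat w φ ∧ M.sat w ψ
  | w, BForm.or φ ψ => M.sat w φ ∨ M.sat w ψ
  | w, BForm.bel a φ => ∀ t, M.R a w t → M.sat t φ

/-- A pointed Kripke model. -/
structure PKripke (A P : Type) where
  M : Kripke A P
  s : M.W

/-- Membership of a belief formula in the belief set of a pointed Kripke model. -/
def PKripke.sat {A P : Type} (K : PKripke A P) (φ : BForm A P) : Prop :=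
  K.M.sat K.s φ

/-- First-degree subset relation between the belief sets of two pointed Kripke models. -/
def fdSub {A P : Type} (K₁ K₂ : PKripke A P) : Prop :=
  ∀ (a : A) (φ : PForm P),
    K₁.sat (BForm.bel a (PForm.toB φ)) → K₂.sat (BForm.bel a (PForm.toB φ))

/-- The expansion of the Kripke model `M` at `s` by the belief `B_a φ`:
worlds are the originals `Sum.inl u`, the replicas `Sum.inr (Sum.inl u)`, and the
fresh designated world `Sum.inr (Sum.inr ())`. -/
def Kripke.expand {A P : Type} (M : Kripke A P) (s : M.W) (a : A) (φ : PForm P) :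
    Kripke A P where
  W := M.W ⊕ (M.W ⊕ Unit)
  R := fun x w v =>
    match w, v with
    | Sum.inl u, Sum.inl v => M.R x u v
    | Sum.inr (Sum.inl u), Sum.inr (Sum.inl v) =>
        M.R x u v ∧ (x = a → PForm.sat (M.val v) φ)
    | Sum.inr (Sum.inr _), Sum.inl v => x ≠ a ∧ M.R x s v
    | Sum.inr (Sum.inr _), Sum.inr (Sum.inl v) =>
        x = a ∧ M.R a s v ∧ PForm.sat (M.val v) φ
    | _, _ => False
  val := fun w =>
    match w with
    | Sum.inl u => M.val u
    | Sum.inr (Sum.inl u) => M.val u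
    | Sum.inr (Sum.inr _) => M.val s

/-- Expansion of a pointed Kripke model by `B_a φ`. -/
def PKripke.expand {A P : Type} (K : PKripke A P) (a : A) (φ : PForm P) : PKripke A P :=
  ⟨K.M.expand K.s a φ, Sum.inr (Sum.inr ())⟩

/-- The generic minimal Kripke model: worlds `2^P`, total accessibility, identity valuation. -/
def Kripke.minimal (A P : Type) : Kripke A P where
  W := Set P
  R := fun _ _ _ => True
  val := id

open Classical in
/-- Full-meet multi-agent belief revision of a pointed Kripke model by `B_a φ`. -/
noncomputable def PKripke.fm {A P : Type} (K : PKripke A P) (a : A) (φ : PForm P) :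
    PKripke A P :=
  if K.sat (BForm.bel a (PForm.toB (PForm.neg φ)))
  then PKripke.expand ⟨Kripke.minimal A P, K.M.val K.s⟩ a φ
  else K.expand a φ

theorem Kripke.sat_toB {A P : Type} (M : Kripke A P) (w : M.W) (φ : PForm P) :
    M.sat w φ.toB ↔ φ.sat (M.val w) := by
  induction φ with
  | atom p => rfl
  | neg φ ih => exact not_congr ih
  | and φ ψ ih₁ ih₂ => exact and_congr ih₁ ih₂
  | or φ ψ ih₁ ih₂ => exact or_congr ih₁ ih₂

/-- The valuations of the worlds that agent `x` considers possible at the designated world. -/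
def PKripke.accessible {A P : Type} (K : PKripke A P) (x : A) : Set (Set P) :=
  {v | ∃ t, K.M.R x K.s t ∧ K.M.val t = v}

theorem PKripke.sat_bel_toB {A P : Type} (K : PKripke A P) (x : A) (φ : PForm P) :
    K.sat (BForm.bel x φ.toB) ↔ ∀ v ∈ K.accessible x, φ.sat v := by
  constructor
  · rintro h _ ⟨t, ht, rfl⟩
    exact (K.M.sat_toB t φ).1 (h t ht)
  · intro h t ht
    exact (K.M.sat_toB t φ).2 (h _ ⟨t, ht, rfl⟩)

theorem PKripke.mem_accessible_expand {A P : Type} (K : PKripke A P) (a x : A)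
    (φ : PForm P) (v : Set P) :
    v ∈ (K.expand a φ).accessible x ↔ v ∈ K.accessible x ∧ (x = a → φ.sat v) := by
  constructor
  · rintro ⟨t | t | t, ht, rfl⟩
    · exact ⟨⟨t, ht.2, rfl⟩, fun hx => absurd hx ht.1⟩
    · obtain ⟨rfl, hR, hφ⟩ := ht
      exact ⟨⟨t, hR, rfl⟩, fun _ => hφ⟩
    · exact ht.elim
  · rintro ⟨⟨t, ht, rfl⟩, hφ⟩
    by_cases hx : x = a
    · subst hx
      exact ⟨Sum.inr (Sum.inl t), ⟨rfl, ht, hφ rfl⟩, rfl⟩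
    · exact ⟨Sum.inl t, ⟨hx, ht⟩, rfl⟩

theorem fdSub_of_accessible_subset {A P : Type} {K₁ K₂ : PKripke A P}
    (h : ∀ x, K₂.accessible x ⊆ K₁.accessible x) : fdSub K₁ K₂ := by
  intro x χ hχ
  rw [PKripke.sat_bel_toB] at hχ ⊢
  exact fun v hv => hχ v (h x hv)

/-- Expanding successively by two beliefs of an agent yields at most the first-degree beliefs
obtained by expanding by their conjunction. -/
theorem PKripke.fdSub_expand_expand {A P : Type} (K : PKripke A P) (a : A) (φ ψ : PForm P) :
    fdSub ((K.expand a φ).expand a ψ) (K.expand a (PForm.and φ ψ)) := by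
  refine fdSub_of_accessible_subset fun x v hv => ?_
  rw [mem_accessible_expand] at hv
  rw [mem_accessible_expand, mem_accessible_expand]
  exact ⟨⟨hv.1, fun hx => (hv.2 hx).1⟩, fun hx => (hv.2 hx).2⟩

theorem fm_subexpansion {A P : Type} [Fintype A] [Nonempty A] [Fintype P]
    (K : PKripke A P) (a : A) (φ ψ : PForm P)
    (h : ¬ (K.fm a φ).sat (BForm.bel a (PForm.toB (PForm.neg ψ)))) :
    fdSub ((K.fm a φ).expand a ψ) (K.fm a (PForm.and φ ψ)) := by
  by_cases hφ : K.sat (BForm.bel a (PForm.toB (PForm.neg φ)))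
  · have hφψ : K.sat (BForm.bel a (PForm.toB (PForm.neg (PForm.and φ ψ)))) := by
      rw [PKripke.sat_bel_toB] at hφ ⊢
      exact fun v hv hand => hφ v hv hand.1
    rw [PKripke.fm, if_pos hφ, PKripke.fm, if_pos hφψ]
    exact PKripke.fdSub_expand_expand _ a φ ψ
  · rw [PKripke.fm, if_neg hφ] at h ⊢
    have hφψ : ¬ K.sat (BForm.bel a (PForm.toB (PForm.neg (PForm.and φ ψ)))) := by
      contrapose! h
      rw [PKripke.sat_bel_toB] at h ⊢
      intro v hv hψ
      rw [PKripke.mem_accessible_expand] at hv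
      exact h v hv.1 ⟨hv.2 rfl, hψ⟩
    rw [PKripke.fm, if_neg hφψ]
    exact K.fdSub_expand_expand a φ ψ
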